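/- arXiv:2507.17525 — 3 statements merged into one kernel-verified Lean document; each statement's English description precedes it below -/
import Mathlib

section
/- Let B₁, B₂ ∈ 𝓛(ℋ) be indefinite selfadjoint operators. Then {B₁, B₂} is weakly indefinite if and only if B₁ is indefinite on Q₂ and B₂ is indefinite on Q₁ (i.e. for j ≠ i the quadratic form of Bᵢ takes both positive and negative values on Q_j). -/
open scoped InnerProductSpace

variable {H : Type*} [NormedAddCommGroup H] [InnerProductSpace ℂ H] [CompleteSpace H]

/-- The real quadratic form `x ↦ Re⟨B x, x⟩` associated to a bounded operator `B`. -/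
noncomputable def qf (B : H →L[ℂ] H) (x : H) : ℝ := (⟪B x, x⟫_ℂ).re

/-- An operator `A` is positive semidefinite if `⟨A x, x⟩ ≥ 0` for all `x`. -/
def PosSemidef (A : H →L[ℂ] H) : Prop := ∀ x : H, 0 ≤ qf A x

/-- A selfadjoint operator is indefinite if its quadratic form takes both strictly
positive and strictly negative values. -/
def Indefinite (B : H →L[ℂ] H) : Prop := (∃ x : H, 0 < qf B x) ∧ (∃ x : H, qf B x < 0)

/-- `Q(B)` : the set of neutral vectors of the quadratic form of `B`. -/
def Qset (B : H →L[ℂ] H) : Set H := {x : H | qf B x = 0}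

/-- `B` is indefinite on a set `S` if its quadratic form takes both strictly positive
and strictly negative values on `S`. -/
def IndefiniteOn (B : H →L[ℂ] H) (S : Set H) : Prop :=
  (∃ x ∈ S, 0 < qf B x) ∧ (∃ x ∈ S, qf B x < 0)

/-- A family `{B₁,…,B_m}` is weakly indefinite if every nontrivial real linear
combination `∑ μᵢ Bᵢ` is indefinite. -/
def WeaklyIndefinite {m : ℕ} (B : Fin m → (H →L[ℂ] H)) : Prop :=
  ∀ μ : Fin m → ℝ, μ ≠ 0 → Indefinite (∑ i, μ i • B i)

/-- A family `{B₁,…,B_m}` is indefinite if each `B_j` is indefinite on `⋂_{i≠j} Qᵢ`. -/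
def IndefiniteFamily {m : ℕ} (B : Fin m → (H →L[ℂ] H)) : Prop :=
  ∀ j : Fin m, IndefiniteOn (B j) {x : H | ∀ i, i ≠ j → qf (B i) x = 0}

theorem qf_smul (B : H →L[ℂ] H) (c : ℂ) (x : H) : qf B (c • x) = ‖c‖ ^ 2 * qf B x := by
  unfold qf
  rw [map_smul, inner_smul_left, inner_smul_right, ← mul_assoc, Complex.conj_mul',
    ← Complex.ofReal_pow, Complex.re_ofReal_mul]

theorem qf_add_vec {B : H →L[ℂ] H} (hB : IsSelfAdjoint B) (x y : H) :
    qf B (x + y) = qf B x + qf B y + 2 * (⟪B x, y⟫_ℂ).re := by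
  have h : (⟪B y, x⟫_ℂ).re = (⟪B x, y⟫_ℂ).re := by
    rw [← ContinuousLinearMap.adjoint_inner_right, hB.adjoint_eq, ← inner_conj_symm,
      Complex.conj_re]
  simp only [qf, map_add, inner_add_left, inner_add_right, Complex.add_re]
  linarith

theorem qf_neg_op (B : H →L[ℂ] H) (x : H) : qf (-B) x = -qf B x := by
  simp [qf]

theorem qf_sum_pair (B₁ B₂ : H →L[ℂ] H) (μ : Fin 2 → ℝ) (x : H) :
    qf (∑ i, μ i • ![B₁, B₂] i) x = μ 0 * qf B₁ x + μ 1 * qf B₂ x := by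
  simp only [qf, Fin.sum_univ_two, Matrix.cons_val_zero, Matrix.cons_val_one,
    add_apply, smul_apply, inner_add_left,
    inner_smul_left_eq_smul, Complex.add_re, Complex.smul_re, smul_eq_mul]

/-- Some phase rotates `z` onto the imaginary axis and `w` into the right half-plane. -/
theorem exists_norm_eq_one_re_mul (z w : ℂ) :
    ∃ c : ℂ, ‖c‖ = 1 ∧ (c * z).re = 0 ∧ 0 ≤ (c * w).re := by
  obtain ⟨d, hd, hdz⟩ : ∃ d : ℂ, ‖d‖ = 1 ∧ (d * z).re = 0 := by
    obtain ⟨c, hc, hcz⟩ := RCLike.exists_norm_eq_mul_self z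
    refine ⟨Complex.I * c, by simp [hc], ?_⟩
    rw [mul_assoc, ← hcz]
    simp
  rcases le_total 0 (d * w).re with h | h
  · exact ⟨d, hd, hdz, h⟩
  · exact ⟨-d, by simpa using hd, by simp only [neg_mul, Complex.neg_re, hdz, neg_zero],
      by simpa only [neg_mul, Complex.neg_re, Left.nonneg_neg_iff] using h⟩

theorem qf_mul_le_of_nonpos_on_Qset {A B : H →L[ℂ] H} (hA : IsSelfAdjoint A)
    (hB : IsSelfAdjoint B) (h : ∀ x ∈ Qset B, qf A x ≤ 0) {u v : H} (hu : 0 < qf B u)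
    (hv : qf B v < 0) : qf B u * qf A v ≤ qf B v * qf A u := by
  obtain ⟨c, hc, hcB, hcA⟩ := exists_norm_eq_one_re_mul ⟪B u, v⟫_ℂ ⟪A u, v⟫_ℂ
  set a : ℝ := √(-qf B v)
  set b : ℝ := √(qf B u)
  have ha : a ^ 2 = -qf B v := Real.sq_sqrt (by linarith)
  have hb : b ^ 2 = qf B u := Real.sq_sqrt hu.le
  have key : ∀ {T : H →L[ℂ] H}, IsSelfAdjoint T →
      qf T ((a : ℂ) • u + ((b : ℂ) * c) • v) =
        -qf B v * qf T u + qf B u * qf T v + 2 * (a * b * (c * ⟪T u, v⟫_ℂ).re) := by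
    intro T hT
    have e : ⟪T ((a : ℂ) • u), ((b : ℂ) * c) • v⟫_ℂ = ((a * b : ℝ) : ℂ) * (c * ⟪T u, v⟫_ℂ) := by
      rw [map_smul, inner_smul_left, inner_smul_right, Complex.conj_ofReal]
      push_cast
      ring
    rw [qf_add_vec hT, e, Complex.re_ofReal_mul, qf_smul, qf_smul, norm_mul, hc, mul_one,
      Complex.norm_real, Complex.norm_real, Real.norm_eq_abs, Real.norm_eq_abs, sq_abs, sq_abs,
      ha, hb]
  have hx := h _ (show qf B ((a : ℂ) • u + ((b : ℂ) * c) • v) = 0 by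
    rw [key hB, hcB]
    ring)
  rw [key hA] at hx
  have : 0 ≤ a * b * (c * ⟪A u, v⟫_ℂ).re := by positivity
  linarith

/-- The S-lemma with an equality constraint: a form that is nonpositive on the neutral vectors of
an indefinite form is dominated by a real multiple of it. -/
theorem exists_qf_le_mul_of_nonpos_on_Qset {A B : H →L[ℂ] H} (hA : IsSelfAdjoint A)
    (hB : IsSelfAdjoint B) (hi : Indefinite B) (h : ∀ x ∈ Qset B, qf A x ≤ 0) :
    ∃ r : ℝ, ∀ x, qf A x ≤ r * qf B x := by
  obtain ⟨⟨u₀, hu₀⟩, v₀, hv₀⟩ := hi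
  have hle : ∀ {u v : H}, 0 < qf B u → qf B v < 0 → qf A u / qf B u ≤ qf A v / qf B v := by
    intro u v hu hv
    rw [div_le_iff₀ hu, div_mul_eq_mul_div, le_div_iff_of_neg hv]
    linarith [qf_mul_le_of_nonpos_on_Qset hA hB h hu hv]
  let S : Set ℝ := {t | ∃ u, 0 < qf B u ∧ t = qf A u / qf B u}
  have hne : S.Nonempty := ⟨_, u₀, hu₀, rfl⟩
  have hub : ∀ {v : H}, qf B v < 0 → ∀ t ∈ S, t ≤ qf A v / qf B v := by
    rintro v hv _ ⟨u, hu, rfl⟩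
    exact hle hu hv
  refine ⟨sSup S, fun x => ?_⟩
  rcases lt_trichotomy (qf B x) 0 with hx | hx | hx
  · exact (le_div_iff_of_neg hx).1 (csSup_le hne (hub hx))
  · rw [hx, mul_zero]
    exact h x hx
  · exact (div_le_iff₀ hx).1 (le_csSup ⟨_, hub hv₀⟩ ⟨x, hx, rfl⟩)

theorem indefiniteOn_Qset {A B : H →L[ℂ] H} (hA : IsSelfAdjoint A) (hB : IsSelfAdjoint B)
    (hi : Indefinite B)
    (h : ∀ r : ℝ, (∃ x, r * qf B x < qf A x) ∧ ∃ x, qf A x < r * qf B x) :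
    IndefiniteOn A (Qset B) := by
  constructor
  · by_contra! hn
    obtain ⟨r, hr⟩ := exists_qf_le_mul_of_nonpos_on_Qset hA hB hi hn
    obtain ⟨x, hx⟩ := (h r).1
    exact (hr x).not_gt hx
  · by_contra! hn
    obtain ⟨r, hr⟩ := exists_qf_le_mul_of_nonpos_on_Qset hA.neg hB hi
      (fun x hx => by rw [qf_neg_op]; linarith [hn x hx])
    obtain ⟨x, hx⟩ := (h (-r)).2
    have := hr x
    rw [qf_neg_op] at this
    linarith

/-- For two indefinite selfadjoint operators, `{B₁, B₂}` is weakly indefinite iff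
`B₁` is indefinite on `Q₂` and `B₂` is indefinite on `Q₁`. -/
theorem weaklyIndefinite_pair_iff (B₁ B₂ : H →L[ℂ] H)
    (h1 : IsSelfAdjoint B₁) (h2 : IsSelfAdjoint B₂)
    (hi1 : Indefinite B₁) (hi2 : Indefinite B₂) :
    WeaklyIndefinite ![B₁, B₂] ↔
      (IndefiniteOn B₁ (Qset B₂) ∧ IndefiniteOn B₂ (Qset B₁)) := by
  constructor
  · intro hw
    have hcomb : ∀ s t : ℝ, s ≠ 0 ∨ t ≠ 0 →
        (∃ x, 0 < s * qf B₁ x + t * qf B₂ x) ∧ ∃ x, s * qf B₁ x + t * qf B₂ x < 0 := by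
      intro s t hst
      have hne : ![s, t] ≠ 0 := by
        intro h0
        have hs := congrFun h0 0
        have ht := congrFun h0 1
        simp_all
      simpa only [Indefinite, qf_sum_pair, Matrix.cons_val_zero, Matrix.cons_val_one]
        using hw _ hne
    refine ⟨indefiniteOn_Qset h1 h2 hi2 fun r => ?_, indefiniteOn_Qset h2 h1 hi1 fun r => ?_⟩
    · obtain ⟨⟨x, hx⟩, y, hy⟩ := hcomb 1 (-r) (Or.inl one_ne_zero)
      exact ⟨⟨x, by linarith⟩, y, by linarith⟩
    · obtain ⟨⟨x, hx⟩, y, hy⟩ := hcomb (-r) 1 (Or.inr one_ne_zero)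
      exact ⟨⟨x, by linarith⟩, y, by linarith⟩
  · rintro ⟨⟨⟨p, hp, hp'⟩, q, hq, hq'⟩, ⟨p₂, hp₂, hp₂'⟩, q₂, hq₂, hq₂'⟩ μ hμ
    simp only [Qset, Set.mem_ofPred_eq] at hp hq hp₂ hq₂
    simp only [Indefinite, qf_sum_pair]
    rcases lt_trichotomy (μ 0) 0 with h0 | h0 | h0
    · exact ⟨⟨q, by rw [hq]; nlinarith⟩, p, by rw [hp]; nlinarith⟩
    · have hne : μ 1 ≠ 0 := fun h => hμ (by ext i; fin_cases i <;> assumption)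
      rcases hne.lt_or_gt with h | h
      · exact ⟨⟨q₂, by rw [hq₂]; nlinarith⟩, p₂, by rw [hp₂]; nlinarith⟩
      · exact ⟨⟨p₂, by rw [hp₂]; nlinarith⟩, q₂, by rw [hq₂]; nlinarith⟩
    · exact ⟨⟨p, by rw [hp]; nlinarith⟩, q, by rw [hq]; nlinarith⟩
end

section
/- Let {B₁,…,B_m} be a strongly indefinite set of selfadjoint operators on ℋ with m ≥ 2. Fix i ∈ {1,…,m} and suppose x₋ ∈ 𝒫ᵢ⁻ ∩ ⋂_{j≠i} Q_j and x₊ ∈ 𝒫ᵢ⁺ ∩ ⋂_{j≠i} Q_j. Then there exists θ ∈ [0, π) such that the segments [x₋, e^{iθ}x₊] and [x₋, −e^{iθ}x₊] are contained in ⋂_{j≠i} Q_j; moreover, there exist vectors y⁺ ∈ (x₋, e^{iθ}x₊) and y⁻ ∈ (x₋, −e^{iθ}x₊) such that y^± ∈ ⋂_{i=1}^m Qᵢ and y^± ∉ N(∑_{j=1}^m μ_jB_j) for every (μ₁,…,μ_m) ∈ ℝ^m with μᵢ ≠ 0, where N denotes the kernel. -/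
open scoped InnerProductSpace

variable {H : Type*} [NormedAddCommGroup H] [InnerProductSpace ℂ H] [CompleteSpace H]

/-- A family `{B₁,…,B_m}` is strongly indefinite if it is weakly indefinite and for all
indices `i, j, k`, whenever `x₋ ∈ 𝒫ᵢ⁻ ∩ Q_j ∩ Q_k` and `x₊ ∈ 𝒫ᵢ⁺ ∩ Q_j ∩ Q_k` there is
`θ ∈ [0, π)` with `Re⟨B_j x₊, e^{iθ} x₋⟩ = Re⟨B_k x₊, e^{iθ} x₋⟩ = 0`. -/
def StronglyIndefinite {m : ℕ} (B : Fin m → (H →L[ℂ] H)) : Prop :=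
  WeaklyIndefinite B ∧
  ∀ i j k : Fin m, ∀ xm xp : H,
    qf (B i) xm < 0 → qf (B j) xm = 0 → qf (B k) xm = 0 →
    0 < qf (B i) xp → qf (B j) xp = 0 → qf (B k) xp = 0 →
    ∃ θ : ℝ, θ ∈ Set.Ico 0 Real.pi ∧
      (⟪(B j) xp, Complex.exp (θ * Complex.I) • xm⟫_ℂ).re = 0 ∧
      (⟪(B k) xp, Complex.exp (θ * Complex.I) • xm⟫_ℂ).re = 0

/-- A family of complex numbers any two of which can be rotated simultaneously into the imaginary
axis can be rotated into it by a single angle. -/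
theorem exists_common_rotation_re_eq_zero {ι : Type*} (s : Set ι) (c : ι → ℂ)
    (h : ∀ j ∈ s, ∀ k ∈ s, ∃ φ ∈ Set.Ico 0 Real.pi,
      (Complex.exp ((φ : ℝ) * Complex.I) * c j).re = 0 ∧
      (Complex.exp ((φ : ℝ) * Complex.I) * c k).re = 0) :
    ∃ φ ∈ Set.Ico 0 Real.pi, ∀ j ∈ s, (Complex.exp ((φ : ℝ) * Complex.I) * c j).re = 0 := by
  by_cases hc : ∃ k ∈ s, c k ≠ 0
  · obtain ⟨k, hk, hck⟩ := hc
    obtain ⟨φ, hφ, hφk, -⟩ := h k hk k hk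
    refine ⟨φ, hφ, fun j hj ↦ ?_⟩
    obtain ⟨ψ, -, hψk, hψj⟩ := h k hk j hj
    simp only [Complex.mul_re, Complex.exp_ofReal_mul_I_re, Complex.exp_ofReal_mul_I_im]
      at hφk hψk hψj ⊢
    have hcross : (c k).re * (c j).im - (c k).im * (c j).re = 0 := by
      linear_combination
        (-((c k).re * (c j).im - (c k).im * (c j).re)) * Real.sin_sq_add_cos_sq ψ
          + (Real.cos ψ * (c j).im + Real.sin ψ * (c j).re) * hψk
          - (Real.cos ψ * (c k).im + Real.sin ψ * (c k).re) * hψj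
    have hnorm : (c k).re ^ 2 + (c k).im ^ 2 ≠ 0 := by
      intro h0
      exact hck (Complex.ext (by simp; nlinarith [sq_nonneg (c k).re, sq_nonneg (c k).im])
        (by simp; nlinarith [sq_nonneg (c k).re, sq_nonneg (c k).im]))
    refine (mul_eq_zero.mp ?_).resolve_left hnorm
    linear_combination ((c k).re * (c j).re + (c k).im * (c j).im) * hφk
      - (Real.cos φ * (c k).im + Real.sin φ * (c k).re) * hcross
  · push Not at hc
    exact ⟨0, ⟨le_rfl, Real.pi_pos⟩, fun j hj ↦ by simp [hc j hj]⟩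

/-- Up to a sign, the conjugate of `e^{iφ}` is again `e^{iθ}` with `θ ∈ [0, π)`. -/
theorem exists_conj_exp_eq_or_neg {φ : ℝ} (hφ : φ ∈ Set.Ico 0 Real.pi) :
    ∃ θ ∈ Set.Ico 0 Real.pi,
      starRingEnd ℂ (Complex.exp ((θ : ℝ) * Complex.I)) = Complex.exp (φ * Complex.I) ∨
      starRingEnd ℂ (Complex.exp ((θ : ℝ) * Complex.I)) = -Complex.exp (φ * Complex.I) := by
  rcases hφ.1.eq_or_lt with rfl | h0
  · exact ⟨0, hφ, by simp⟩
  · refine ⟨Real.pi - φ, ⟨by linarith [hφ.2], by linarith⟩, Or.inr ?_⟩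
    apply Complex.ext <;>
      simp only [Complex.conj_re, Complex.conj_im, Complex.neg_re, Complex.neg_im,
        Complex.exp_ofReal_mul_I_re, Complex.exp_ofReal_mul_I_im, Real.cos_pi_sub,
        Real.sin_pi_sub]

theorem re_inner_comm_of_isSelfAdjoint {B : H →L[ℂ] H} (hB : IsSelfAdjoint B) (x y : H) :
    (⟪B x, y⟫_ℂ).re = (⟪B y, x⟫_ℂ).re := by
  rw [hB.isSymmetric.apply_clm x y, ← inner_conj_symm, Complex.conj_re]

theorem qf_smul_add_smul {B : H →L[ℂ] H} (hB : IsSelfAdjoint B) (x z : H) (a b : ℝ) :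
    qf B (a • x + b • z) =
      a ^ 2 * qf B x + 2 * a * b * (⟪B z, x⟫_ℂ).re + b ^ 2 * qf B z := by
  have hsymm := re_inner_comm_of_isSelfAdjoint hB x z
  simp only [qf, RCLike.real_smul_eq_coe_smul (K := ℂ), map_add, map_smul, inner_add_left,
    inner_add_right, inner_smul_left, inner_smul_right, Complex.add_re]
  simp
  linear_combination a * b * hsymm

omit [CompleteSpace H] in
theorem continuous_qf (B : H →L[ℂ] H) : Continuous (qf B) := by
  unfold qf
  fun_prop

omit [CompleteSpace H] in
theorem exists_qf_segment_eq_zero {B : H →L[ℂ] H} {x z : H} (hx : qf B x < 0) (hz : 0 < qf B z) :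
    ∃ t ∈ Set.Ioo (0 : ℝ) 1, qf B (t • x + (1 - t) • z) = 0 := by
  have hcont : ContinuousOn (fun t : ℝ ↦ qf B (t • x + (1 - t) • z)) (Set.Icc 0 1) :=
    ((continuous_qf B).comp (by fun_prop)).continuousOn
  exact intermediate_value_Ioo' zero_le_one hcont (by simpa using ⟨hx, hz⟩)

omit [CompleteSpace H] in
theorem re_inner_sum_smul_apply {ι : Type*} [Fintype ι] (B : ι → (H →L[ℂ] H)) (μ : ι → ℝ)
    (x y : H) : (⟪(∑ j, μ j • B j) x, y⟫_ℂ).re = ∑ j, μ j * (⟪B j x, y⟫_ℂ).re := by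
  simp only [sum_apply, smul_apply, sum_inner, Complex.re_sum,
    RCLike.real_smul_eq_coe_smul (K := ℂ), inner_smul_left]
  simp

/-- A vector strictly between a negative and a positive vector of `B i`, which span an isotropic
plane for all the other forms, is not annihilated by a combination charging `B i`. -/
theorem sum_smul_apply_segment_ne_zero {ι : Type*} [Fintype ι] {B : ι → (H →L[ℂ] H)}
    (hB : ∀ i, IsSelfAdjoint (B i)) {i : ι} {x z : H}
    (hx : qf (B i) x < 0) (hxQ : ∀ j, j ≠ i → qf (B j) x = 0)
    (hz : 0 < qf (B i) z) (hzQ : ∀ j, j ≠ i → qf (B j) z = 0)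
    (hxz : ∀ j, j ≠ i → (⟪B j z, x⟫_ℂ).re = 0) {t : ℝ} (ht : t ∈ Set.Ioo (0 : ℝ) 1)
    {μ : ι → ℝ} (hμ : μ i ≠ 0) :
    (∑ j, μ j • B j) (t • x + (1 - t) • z) ≠ 0 := by
  intro h
  have hzx (j : ι) := re_inner_comm_of_isSelfAdjoint (hB j) x z
  have hsum (w : H) :
      ∑ j, μ j * (t * (⟪B j x, w⟫_ℂ).re + (1 - t) * (⟪B j z, w⟫_ℂ).re) = 0 := by
    have hw := re_inner_sum_smul_apply B μ (t • x + (1 - t) • z) w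
    rw [h, inner_zero_left, Complex.zero_re] at hw
    rw [hw]
    refine Finset.sum_congr rfl fun j _ ↦ ?_
    simp only [RCLike.real_smul_eq_coe_smul (K := ℂ), map_add, map_smul, inner_add_left,
      inner_smul_left, Complex.add_re]
    simp
  have hx0 : t * qf (B i) x + (1 - t) * (⟪B i z, x⟫_ℂ).re = 0 := by
    have hw := hsum x
    rw [Fintype.sum_eq_single i fun j hj ↦ by
      rw [hxz j hj, show (⟪B j x, x⟫_ℂ).re = 0 from hxQ j hj]; ring] at hw
    exact (mul_eq_zero.mp hw).resolve_left hμ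
  have hz0 : t * (⟪B i z, x⟫_ℂ).re + (1 - t) * qf (B i) z = 0 := by
    have hw := hsum z
    rw [Fintype.sum_eq_single i fun j hj ↦ by
      rw [hzx, hxz j hj, show (⟪B j z, z⟫_ℂ).re = 0 from hzQ j hj]; ring, hzx] at hw
    exact (mul_eq_zero.mp hw).resolve_left hμ
  have h1t : 0 < 1 - t := sub_pos.mpr ht.2
  have hpos : 0 < (⟪B i z, x⟫_ℂ).re :=
    pos_of_mul_pos_right (by linarith [mul_neg_of_pos_of_neg ht.1 hx]) h1t.le
  linarith [mul_pos ht.1 hpos, mul_pos h1t hz]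

/-- A segment joining a negative to a positive vector of `B i`, whose endpoints span an isotropic
plane for all the other forms, is neutral for these and contains a common neutral vector. -/
theorem segment_in_common_neutral {ι : Type*} [Fintype ι] {B : ι → (H →L[ℂ] H)}
    (hB : ∀ i, IsSelfAdjoint (B i)) {i : ι} {x z : H}
    (hx : qf (B i) x < 0) (hxQ : ∀ j, j ≠ i → qf (B j) x = 0)
    (hz : 0 < qf (B i) z) (hzQ : ∀ j, j ≠ i → qf (B j) z = 0)
    (hxz : ∀ j, j ≠ i → (⟪B j z, x⟫_ℂ).re = 0) :
    (∀ t : ℝ, ∀ j, j ≠ i → qf (B j) (t • x + (1 - t) • z) = 0) ∧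
    ∃ t : ℝ, t ∈ Set.Ioo (0 : ℝ) 1 ∧
      (∀ j, qf (B j) (t • x + (1 - t) • z) = 0) ∧
      ∀ μ : ι → ℝ, μ i ≠ 0 → (∑ j, μ j • B j) (t • x + (1 - t) • z) ≠ 0 := by
  have hseg (t : ℝ) (j : ι) (hj : j ≠ i) : qf (B j) (t • x + (1 - t) • z) = 0 := by
    rw [qf_smul_add_smul (hB j), hxQ j hj, hzQ j hj, hxz j hj]; ring
  obtain ⟨t, ht, hti⟩ := exists_qf_segment_eq_zero hx hz
  refine ⟨hseg, t, ht, fun j ↦ ?_, fun μ hμ ↦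
    sum_smul_apply_segment_ne_zero hB hx hxQ hz hzQ hxz ht hμ⟩
  by_cases hj : j = i
  · exact hj ▸ hti
  · exact hseg t j hj

omit [CompleteSpace H] in
theorem qf_exp_smul (B : H →L[ℂ] H) (θ : ℝ) (x : H) :
    qf B (Complex.exp (θ * Complex.I) • x) = qf B x := by
  rw [qf, qf, map_smul, inner_smul_left, inner_smul_right, ← mul_assoc,
    ← Complex.normSq_eq_conj_mul_self, Complex.normSq_eq_norm_sq, Complex.norm_exp_ofReal_mul_I]
  simp

omit [CompleteSpace H] in
theorem qf_neg_right (B : H →L[ℂ] H) (x : H) : qf B (-x) = qf B x := by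
  simp [qf]

/-- For a strongly indefinite family and `x₋ ∈ 𝒫ᵢ⁻ ∩ ⋂_{j≠i} Q_j`,
`x₊ ∈ 𝒫ᵢ⁺ ∩ ⋂_{j≠i} Q_j`, there is `θ ∈ [0, π)` such that the segments
`[x₋, ±e^{iθ}x₊]` lie in `⋂_{j≠i} Q_j`; moreover each open segment `(x₋, ±e^{iθ}x₊)`
contains a vector `y^±` in `⋂_{j=1}^m Q_j` which is not in the kernel of any
`∑_j μ_j B_j` with `μ_i ≠ 0`. -/
theorem segments_in_common_neutral {m : ℕ} (hm : 2 ≤ m) (B : Fin m → (H →L[ℂ] H))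
    (hB : ∀ i, IsSelfAdjoint (B i)) (hstr : StronglyIndefinite B) (i : Fin m)
    (xm xp : H)
    (hxm : qf (B i) xm < 0) (hxmQ : ∀ j, j ≠ i → qf (B j) xm = 0)
    (hxp : 0 < qf (B i) xp) (hxpQ : ∀ j, j ≠ i → qf (B j) xp = 0) :
    ∃ θ : ℝ, θ ∈ Set.Ico 0 Real.pi ∧
      (∀ t : ℝ, t ∈ Set.Icc (0:ℝ) 1 → ∀ j, j ≠ i →
        qf (B j) (t • xm + (1 - t) • (Complex.exp (θ * Complex.I) • xp)) = 0) ∧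
      (∀ t : ℝ, t ∈ Set.Icc (0:ℝ) 1 → ∀ j, j ≠ i →
        qf (B j) (t • xm + (1 - t) • (-(Complex.exp (θ * Complex.I) • xp))) = 0) ∧
      (∃ t : ℝ, t ∈ Set.Ioo (0:ℝ) 1 ∧
        (∀ j, qf (B j) (t • xm + (1 - t) • (Complex.exp (θ * Complex.I) • xp)) = 0) ∧
        (∀ μ : Fin m → ℝ, μ i ≠ 0 →
          (∑ j, μ j • B j) (t • xm + (1 - t) • (Complex.exp (θ * Complex.I) • xp)) ≠ 0)) ∧
      (∃ t : ℝ, t ∈ Set.Ioo (0:ℝ) 1 ∧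
        (∀ j, qf (B j) (t • xm + (1 - t) • (-(Complex.exp (θ * Complex.I) • xp))) = 0) ∧
        (∀ μ : Fin m → ℝ, μ i ≠ 0 →
          (∑ j, μ j • B j) (t • xm + (1 - t) • (-(Complex.exp (θ * Complex.I) • xp))) ≠ 0)) := by
  obtain ⟨φ, hφ, hφB⟩ := exists_common_rotation_re_eq_zero {j | j ≠ i}
    (fun j ↦ ⟪B j xp, xm⟫_ℂ) fun j hj k hk ↦ by
      simpa only [inner_smul_right] using hstr.2 i j k xm xp hxm (hxmQ j hj) (hxmQ k hk)
        hxp (hxpQ j hj) (hxpQ k hk)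
  obtain ⟨θ, hθ, hθφ⟩ := exists_conj_exp_eq_or_neg hφ
  have horth (j : Fin m) (hj : j ≠ i) :
      (⟪B j (Complex.exp (θ * Complex.I) • xp), xm⟫_ℂ).re = 0 := by
    rw [map_smul, inner_smul_left]
    rcases hθφ with h | h <;> rw [h]
    · exact hφB j hj
    · rw [neg_mul, Complex.neg_re, neg_eq_zero]
      exact hφB j hj
  obtain ⟨hseg, hmem⟩ := segment_in_common_neutral hB (z := Complex.exp (θ * Complex.I) • xp)
    hxm hxmQ (by rwa [qf_exp_smul]) (fun j hj ↦ by rw [qf_exp_smul, hxpQ j hj]) horth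
  obtain ⟨hseg', hmem'⟩ := segment_in_common_neutral hB (z := -(Complex.exp (θ * Complex.I) • xp))
    hxm hxmQ (by rwa [qf_neg_right, qf_exp_smul])
    (fun j hj ↦ by rw [qf_neg_right, qf_exp_smul, hxpQ j hj])
    (fun j hj ↦ by rw [map_neg, inner_neg_left, Complex.neg_re, horth j hj, neg_zero])
  exact ⟨θ, hθ, fun t _ ↦ hseg t, fun t _ ↦ hseg' t, hmem, hmem'⟩
end

section
/- Let B₁,…,B_m ∈ 𝓛(ℋ) be selfadjoint with m ≥ 2. The following are equivalent: (i) {B₁,…,B_m} is strongly indefinite; (ii) {B₁,…,B_m} is indefinite and, for all i, j, k, whenever x₋ ∈ 𝒫ᵢ⁻ ∩ Q_j ∩ Q_k and x₊ ∈ 𝒫ᵢ⁺ ∩ Q_j ∩ Q_k there exists θ ∈ [0, π) with Re⟨B_j x₊, e^{iθ}x₋⟩ = Re⟨B_k x₊, e^{iθ}x₋⟩ = 0; (iii) for each i there exists xᵢ ∈ ⋂_{j=1}^m Q_j with xᵢ ∉ N(∑_{j=1}^m μ_jB_j) for every (μ₁,…,μ_m) ∈ ℝ^m with μᵢ ≠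 0, and, for all i, j, k, whenever x₋ ∈ 𝒫ᵢ⁻ ∩ Q_j ∩ Q_k and x₊ ∈ 𝒫ᵢ⁺ ∩ Q_j ∩ Q_k there exist θ ∈ [0, π) and x_θ ∈ (x₋, e^{iθ}x₊) such that x_θ ∈ Qᵢ ∩ Q_j ∩ Q_k. -/
open scoped InnerProductSpace

variable {H : Type*} [NormedAddCommGroup H] [InnerProductSpace ℂ H] [CompleteSpace H]

set_option linter.unusedSectionVars false

/-- The angular condition in the definition of strong indefiniteness. -/
def AngularCondition {m : ℕ} (B : Fin m → (H →L[ℂ] H)) : Prop :=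
  ∀ i j k : Fin m, ∀ xm xp : H,
    qf (B i) xm < 0 → qf (B j) xm = 0 → qf (B k) xm = 0 →
    0 < qf (B i) xp → qf (B j) xp = 0 → qf (B k) xp = 0 →
    ∃ θ : ℝ, θ ∈ Set.Ico 0 Real.pi ∧
      (⟪(B j) xp, Complex.exp (θ * Complex.I) • xm⟫_ℂ).re = 0 ∧
      (⟪(B k) xp, Complex.exp (θ * Complex.I) • xm⟫_ℂ).re = 0

theorem qf_add_real_smul {A : H →L[ℂ] H} (hA : IsSelfAdjoint A) (s t : ℝ) (x y : H) :
    qf A (s • x + t • y) = s ^ 2 * qf A x + t ^ 2 * qf A y + 2 * s * t * (⟪A x, y⟫_ℂ).re := by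
  have hsymm : (⟪A y, x⟫_ℂ).re = (⟪A x, y⟫_ℂ).re := by
    rw [← ContinuousLinearMap.adjoint_inner_right, hA.adjoint_eq, ← inner_conj_symm,
      Complex.conj_re]
  have hsmul : ∀ (r : ℝ) (z : H), r • z = (r : ℂ) • z := fun r z ↦ (Complex.coe_smul r z).symm
  simp only [qf, hsmul, map_add, map_smul, inner_add_left, inner_add_right, inner_smul_left,
    inner_smul_right, Complex.conj_ofReal, Complex.add_re, Complex.re_ofReal_mul, hsymm]
  ring

theorem qf_unit_smul (A : H →L[ℂ] H) {u : ℂ} (hu : ‖u‖ = 1) (x : H) :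
    qf A (u • x) = qf A x := by
  have h : (starRingEnd ℂ) u * u = 1 := by
    rw [mul_comm, Complex.mul_conj, Complex.normSq_eq_norm_sq, hu]; simp
  rw [qf, qf, map_smul, inner_smul_left, inner_smul_right, ← mul_assoc, h, one_mul]

theorem qf_sum_smul {m : ℕ} (B : Fin m → (H →L[ℂ] H)) (μ : Fin m → ℝ) (x : H) :
    qf (∑ i, μ i • B i) x = ∑ i, μ i * qf (B i) x := by
  simp only [qf, sum_apply, smul_apply, sum_inner,
    Complex.re_sum, ← Complex.coe_smul, inner_smul_left, Complex.conj_ofReal,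
    Complex.re_ofReal_mul]

theorem isSelfAdjoint_sum_real_smul {m : ℕ} {B : Fin m → (H →L[ℂ] H)}
    (hB : ∀ i, IsSelfAdjoint (B i)) (μ : Fin m → ℝ) : IsSelfAdjoint (∑ i, μ i • B i) :=
  isSelfAdjoint_sum _ fun i _ ↦ (IsSelfAdjoint.all (μ i)).smul (hB i)

theorem qf_sum_smul_of_forall_ne {m : ℕ} {B : Fin m → (H →L[ℂ] H)} (μ : Fin m → ℝ) {i : Fin m}
    {x : H} (hx : ∀ j, j ≠ i → qf (B j) x = 0) :
    qf (∑ j, μ j • B j) x = μ i * qf (B i) x := by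
  rw [qf_sum_smul, Finset.sum_eq_single i (fun j _ hj ↦ by rw [hx j hj, mul_zero]) (by simp)]

theorem exists_pos_root {b c : ℝ} (hb : 0 < b) (hc : c < 0) (β : ℝ) :
    ∃ t : ℝ, 0 < t ∧ b + t ^ 2 * c + 2 * t * β = 0 := by
  have hlt : |β| < √(β ^ 2 - b * c) := by
    rw [← Real.sqrt_sq_eq_abs]
    exact Real.sqrt_lt_sqrt (sq_nonneg _) (by nlinarith)
  have hsq : √(β ^ 2 - b * c) ^ 2 = β ^ 2 - b * c := Real.sq_sqrt (by nlinarith [sq_nonneg β])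
  refine ⟨(-β - √(β ^ 2 - b * c)) / c, div_pos_of_neg_of_neg ?_ hc, ?_⟩
  · linarith [neg_abs_le β]
  · have hroot : (-β - √(β ^ 2 - b * c)) / c * c = -β - √(β ^ 2 - b * c) :=
      div_mul_cancel₀ _ hc.ne
    generalize (-β - √(β ^ 2 - b * c)) / c = t at hroot
    apply mul_right_cancel₀ hc.ne
    linear_combination hsq + (t * c + β - √(β ^ 2 - b * c)) * hroot

/-- If the binary forms `(b₁, β, b₂)` and `(a₁, α, a₂)` satisfy `b₂ < 0 < b₁` and some
`a - ρ b` is positive at both coordinate vectors, then `a` is positive at a zero of `b`. -/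
theorem exists_zero_pos {a₁ a₂ b₁ b₂ ρ : ℝ} (α β : ℝ) (hb₁ : 0 < b₁) (hb₂ : b₂ < 0)
    (h₁ : ρ * b₁ < a₁) (h₂ : ρ * b₂ < a₂) :
    ∃ t : ℝ, b₁ + t ^ 2 * b₂ + 2 * t * β = 0 ∧ 0 < a₁ + t ^ 2 * a₂ + 2 * t * α := by
  rcases le_total 0 (α - ρ * β) with h | h
  · obtain ⟨t, ht, h0⟩ := exists_pos_root hb₁ hb₂ β
    refine ⟨t, h0, ?_⟩
    nlinarith [mul_nonneg ht.le h, mul_pos (pow_pos ht 2) (sub_pos.2 h₂), congrArg (ρ * ·) h0]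
  · obtain ⟨t, ht, h0⟩ := exists_pos_root hb₁ hb₂ (-β)
    refine ⟨-t, by linarith, ?_⟩
    nlinarith [mul_nonneg ht.le (neg_nonneg.2 h), mul_pos (pow_pos ht 2) (sub_pos.2 h₂),
      congrArg (ρ * ·) h0]

theorem re_mul_eq_zero_of_re_mul_eq_zero {u v w z : ℂ} (hv : v ≠ 0) (hw : w ≠ 0)
    (huw : (u * w).re = 0) (hvw : (v * w).re = 0) (hvz : (v * z).re = 0) : (u * z).re = 0 := by
  have him : (v * w).im ≠ 0 := fun h ↦ mul_ne_zero hv hw (Complex.ext hvw h)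
  have hu : u = (((u * w).im / (v * w).im : ℝ) : ℂ) * v := by
    apply mul_right_cancel₀ hw
    rw [mul_assoc]
    apply Complex.ext
    · rw [Complex.re_ofReal_mul, huw, hvw, mul_zero]
    · rw [Complex.im_ofReal_mul, div_mul_cancel₀ _ him]
  rw [hu, mul_assoc, Complex.re_ofReal_mul, hvz, mul_zero]

/-- The angular condition for pairs yields a common phase for any subfamily. -/
theorem AngularCondition.exists_unit {m : ℕ} {B : Fin m → (H →L[ℂ] H)} (h : AngularCondition B)
    {i : Fin m} {J : Set (Fin m)} {xm xp : H} (hm : qf (B i) xm < 0)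
    (hmJ : ∀ j ∈ J, qf (B j) xm = 0) (hp : 0 < qf (B i) xp) (hpJ : ∀ j ∈ J, qf (B j) xp = 0) :
    ∃ u : ℂ, ‖u‖ = 1 ∧ ∀ j ∈ J, (⟪B j xp, u • xm⟫_ℂ).re = 0 := by
  by_cases h0 : ∀ j ∈ J, ⟪B j xp, xm⟫_ℂ = 0
  · exact ⟨1, norm_one, fun j hj ↦ by rw [one_smul, h0 j hj, Complex.zero_re]⟩
  push Not at h0
  obtain ⟨k, hk, hk0⟩ := h0
  obtain ⟨θ, -, hθ, -⟩ := h i k k xm xp hm (hmJ k hk) (hmJ k hk) hp (hpJ k hk) (hpJ k hk)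
  refine ⟨Complex.exp (θ * Complex.I), Complex.norm_exp_ofReal_mul_I θ, fun j hj ↦ ?_⟩
  obtain ⟨η, -, hηk, hηj⟩ := h i k j xm xp hm (hmJ k hk) (hmJ j hj) hp (hpJ k hk) (hpJ j hj)
  rw [inner_smul_right] at *
  exact re_mul_eq_zero_of_re_mul_eq_zero (Complex.exp_ne_zero _) hk0 hθ hηk hηj

/-- Under the angular condition, nontrivial combinations of the remaining forms are positive
somewhere on the common neutral set of any subfamily. -/
theorem WeaklyIndefinite.exists_pos_on_neutral {m : ℕ} {B : Fin m → (H →L[ℂ] H)}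
    (hB : ∀ i, IsSelfAdjoint (B i)) (hW : WeaklyIndefinite B) (hA : AngularCondition B)
    (J : Finset (Fin m)) : ∀ μ : Fin m → ℝ, μ ≠ 0 → (∀ j ∈ J, μ j = 0) →
      ∃ x : H, (∀ j ∈ J, qf (B j) x = 0) ∧ 0 < qf (∑ i, μ i • B i) x := by
  induction J using Finset.induction_on with
  | empty => exact fun μ hμ _ ↦ (hW μ hμ).1.imp fun x hx ↦ ⟨by simp, hx⟩
  | insert k J hk ih =>
    intro μ hμ hμJ
    rw [Finset.forall_mem_insert] at hμJ
    by_contra! hneg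
    simp only [Finset.forall_mem_insert] at hneg
    set A := ∑ i, μ i • B i with hAdef
    have hAsa : IsSelfAdjoint A := isSelfAdjoint_sum_real_smul hB μ
    have hsingle : ∀ c : ℝ, c ≠ 0 → ∃ x : H, (∀ j ∈ J, qf (B j) x = 0) ∧ 0 < c * qf (B k) x := by
      intro c hc
      obtain ⟨x, hxJ, hx⟩ := ih (Pi.single k c) (by simpa using hc)
        fun j hj ↦ by rw [Pi.single_apply, if_neg (ne_of_mem_of_not_mem hj hk)]
      refine ⟨x, hxJ, ?_⟩
      rw [qf_sum_smul, Finset.sum_eq_single k (fun j _ hj ↦ by simp [hj]) (by simp)] at hx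
      simpa using hx
    obtain ⟨xp, hxpJ, hxp⟩ := hsingle 1 one_ne_zero
    obtain ⟨xm, hxmJ, hxm⟩ := hsingle (-1) (by simp)
    let q : H → ℝ := fun x ↦ qf A x / qf (B k) x
    obtain ⟨ρ, hρp, hρm⟩ := exists_between_of_forall_le
      (s := q '' {x | (∀ j ∈ J, qf (B j) x = 0) ∧ 0 < qf (B k) x})
      (t := q '' {x | (∀ j ∈ J, qf (B j) x = 0) ∧ qf (B k) x < 0})
      ⟨_, xp, ⟨hxpJ, by linarith⟩, rfl⟩ ⟨_, xm, ⟨hxmJ, by linarith⟩, rfl⟩ (by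
        rintro _ ⟨x, ⟨hxJ, hx⟩, rfl⟩ _ ⟨y, ⟨hyJ, hy⟩, rfl⟩
        by_contra! hlt
        obtain ⟨ρ, hyρ, hρx⟩ := exists_between hlt
        obtain ⟨u, hu, hcross⟩ := hA.exists_unit (J := J) hy hyJ hx hxJ
        obtain ⟨t, ht0, htpos⟩ := exists_zero_pos (⟪A x, u • y⟫_ℂ).re (⟪B k x, u • y⟫_ℂ).re
          hx hy ((lt_div_iff₀ hx).1 hρx) ((div_lt_iff_of_neg hy).1 hyρ)
        have hexp : ∀ C : H →L[ℂ] H, IsSelfAdjoint C → qf C ((1 : ℝ) • x + t • (u • y)) =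
            qf C x + t ^ 2 * qf C y + 2 * t * (⟪C x, u • y⟫_ℂ).re := fun C hC ↦ by
          rw [qf_add_real_smul hC, qf_unit_smul C hu]; ring
        refine (hneg ((1 : ℝ) • x + t • (u • y)) ⟨?_, fun j hj ↦ ?_⟩).not_gt ?_
        · rw [hexp _ (hB k), ht0]
        · rw [hexp _ (hB j), hxJ j hj, hyJ j hj, hcross j hj]; ring
        · rwa [hexp _ hAsa])
    obtain ⟨l, hl⟩ := Function.ne_iff.1 hμ
    have hlk : l ≠ k := fun h ↦ hl (by rw [h, hμJ.1]; rfl)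
    obtain ⟨x, hxJ, hx⟩ := ih (μ - Pi.single k ρ)
      (Function.ne_iff.2 ⟨l, by simpa [hlk] using hl⟩)
      fun j hj ↦ by simp [hμJ.2 j hj, ne_of_mem_of_not_mem hj hk]
    have hsum : qf (∑ i, (μ - Pi.single k ρ : Fin m → ℝ) i • B i) x = qf A x - ρ * qf (B k) x := by
      rw [hAdef, qf_sum_smul, qf_sum_smul]
      simp [sub_mul, Finset.sum_sub_distrib, Pi.single_apply]
    rw [hsum] at hx
    rcases lt_trichotomy (qf (B k) x) 0 with hb | hb | hb
    · have := hρm ⟨x, ⟨hxJ, hb⟩, rfl⟩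
      have := (le_div_iff_of_neg hb).1 this
      linarith
    · have := hneg x ⟨hb, hxJ⟩
      rw [hb] at hx
      linarith
    · have := hρp ⟨x, ⟨hxJ, hb⟩, rfl⟩
      have := (div_le_iff₀ hb).1 this
      linarith

theorem WeaklyIndefinite.indefiniteFamily {m : ℕ} {B : Fin m → (H →L[ℂ] H)}
    (hB : ∀ i, IsSelfAdjoint (B i)) (hW : WeaklyIndefinite B) (hA : AngularCondition B) :
    IndefiniteFamily B := by
  intro i
  have key : ∀ c : ℝ, c ≠ 0 → ∃ x : H, (∀ j, j ≠ i → qf (B j) x = 0) ∧ 0 < c * qf (B i) x := by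
    intro c hc
    obtain ⟨x, hxJ, hx⟩ := hW.exists_pos_on_neutral hB hA (Finset.univ.erase i) (Pi.single i c)
      (by simpa using hc) fun j hj ↦ by
        rw [Pi.single_apply, if_neg (Finset.ne_of_mem_erase hj)]
    have hxi : ∀ j, j ≠ i → qf (B j) x = 0 := fun j hj ↦ hxJ j (by simpa using hj)
    rw [qf_sum_smul_of_forall_ne _ hxi, Pi.single_eq_same] at hx
    exact ⟨x, hxi, hx⟩
  obtain ⟨xp, hxp, hp⟩ := key 1 one_ne_zero
  obtain ⟨xm, hxm, hm⟩ := key (-1) (by simp)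
  exact ⟨⟨xp, hxp, by linarith⟩, ⟨xm, hxm, by linarith⟩⟩

theorem IndefiniteFamily.weaklyIndefinite {m : ℕ} {B : Fin m → (H →L[ℂ] H)}
    (hI : IndefiniteFamily B) : WeaklyIndefinite B := by
  intro μ hμ
  obtain ⟨i, hi⟩ := Function.ne_iff.1 hμ
  obtain ⟨⟨xp, hxp, hp⟩, ⟨xm, hxm, hm⟩⟩ := hI i
  have hqp := qf_sum_smul_of_forall_ne μ hxp
  have hqm := qf_sum_smul_of_forall_ne μ hxm
  rcases lt_or_gt_of_ne hi with hi | hi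
  · exact ⟨⟨xm, hqm ▸ mul_pos_of_neg_of_neg hi hm⟩, ⟨xp, hqp ▸ mul_neg_of_neg_of_pos hi hp⟩⟩
  · exact ⟨⟨xp, hqp ▸ mul_pos hi hp⟩, ⟨xm, hqm ▸ mul_neg_of_pos_of_neg hi hm⟩⟩

theorem IndefiniteFamily.exists_neutral_notMem_ker {m : ℕ} {B : Fin m → (H →L[ℂ] H)}
    (hB : ∀ i, IsSelfAdjoint (B i)) (hI : IndefiniteFamily B) (hA : AngularCondition B)
    (i : Fin m) : ∃ x : H, (∀ j, qf (B j) x = 0) ∧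
      ∀ μ : Fin m → ℝ, μ i ≠ 0 → (∑ j, μ j • B j) x ≠ 0 := by
  obtain ⟨⟨xp, hxp, hp⟩, ⟨xm, hxm, hm⟩⟩ := hI i
  obtain ⟨u, hu, hcross⟩ := hA.exists_unit (J := {j | j ≠ i}) hm hxm hp hxp
  obtain ⟨t, ht, ht0⟩ := exists_pos_root hp hm (⟪B i xp, u • xm⟫_ℂ).re
  have hexp : ∀ C : H →L[ℂ] H, IsSelfAdjoint C → qf C ((1 : ℝ) • xp + t • (u • xm)) =
      qf C xp + t ^ 2 * qf C xm + 2 * t * (⟪C xp, u • xm⟫_ℂ).re := fun C hC ↦ by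
    rw [qf_add_real_smul hC, qf_unit_smul C hu]; ring
  refine ⟨(1 : ℝ) • xp + t • (u • xm), fun j ↦ ?_, fun μ hμ h0 ↦ ?_⟩
  · rw [hexp _ (hB j)]
    by_cases hj : j = i
    · rw [hj, ht0]
    · rw [hxp j hj, hxm j hj, hcross j hj]; ring
  · set C := ∑ j, μ j • B j with hC
    set z := (1 : ℝ) • xp + t • (u • xm) with hz
    have hxpz : xp = (1 : ℝ) • z + (-t) • (u • xm) := by rw [hz]; module
    have hzz : qf C z = 0 := by rw [qf, h0, inner_zero_left, Complex.zero_re]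
    have hq : qf C xp = t ^ 2 * qf C xm := by
      conv_lhs => rw [hxpz]
      rw [qf_add_real_smul (isSelfAdjoint_sum_real_smul hB μ), qf_unit_smul C hu, hzz, h0,
        inner_zero_left, Complex.zero_re]
      ring
    rw [hC, qf_sum_smul_of_forall_ne μ hxp, qf_sum_smul_of_forall_ne μ hxm] at hq
    have : qf (B i) xp = t ^ 2 * qf (B i) xm := mul_left_cancel₀ hμ (by linear_combination hq)
    nlinarith [mul_neg_of_pos_of_neg (pow_pos ht 2) hm]

theorem indefinite_of_neutral_notMem_ker {C : H →L[ℂ] H} (hC : IsSelfAdjoint C) {x : H}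
    (hx : qf C x = 0) (hCx : C x ≠ 0) : Indefinite C := by
  have hexp : ∀ s : ℝ, qf C ((1 : ℝ) • x + s • C x) =
      s ^ 2 * qf C (C x) + 2 * s * ‖C x‖ ^ 2 := fun s ↦ by
    rw [qf_add_real_smul hC, hx,
      show (⟪C x, C x⟫_ℂ).re = ‖C x‖ ^ 2 from (norm_sq_eq_re_inner (𝕜 := ℂ) (C x)).symm]
    ring
  have hn : 0 < ‖C x‖ ^ 2 := by positivity
  set c := qf C (C x) with hc
  set n := ‖C x‖ ^ 2 with hndef
  have hden : 0 < |c| + 1 := by positivity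
  set s := n / (|c| + 1) with hs
  have hspos : 0 < s := div_pos hn hden
  have hsc : s * |c| < n := by
    have : s * (|c| + 1) = n := div_mul_cancel₀ _ hden.ne'
    nlinarith
  refine ⟨⟨_, lt_of_lt_of_eq ?_ (hexp s).symm⟩, ⟨_, (hexp (-s)).trans_lt ?_⟩⟩
  · nlinarith [mul_le_mul_of_nonneg_left (neg_abs_le c) hspos.le]
  · nlinarith [mul_le_mul_of_nonneg_left (le_abs_self c) hspos.le]

theorem re_inner_exp_smul_left (x y : H) (θ : ℝ) :
    (⟪Complex.exp (θ * Complex.I) • x, y⟫_ℂ).re =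
      (⟪x, Complex.exp ((-θ : ℝ) * Complex.I) • y⟫_ℂ).re := by
  rw [inner_smul_left, inner_smul_right, ← Complex.exp_conj]
  simp

/-- Reflecting the phase: `-θ` has a representative modulo `π` in `[0, π)`. -/
theorem exists_phase_neg {θ : ℝ} (hθ : θ ∈ Set.Ico 0 Real.pi) :
    ∃ η ∈ Set.Ico 0 Real.pi, ∀ x y : H,
      (⟪x, Complex.exp (θ * Complex.I) • y⟫_ℂ).re = 0 ↔
        (⟪Complex.exp (η * Complex.I) • x, y⟫_ℂ).re = 0 := by
  rcases hθ.1.eq_or_lt with rfl | h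
  · exact ⟨0, hθ, fun x y ↦ by simp⟩
  · refine ⟨Real.pi - θ, ⟨by linarith [hθ.2], by linarith⟩, fun x y ↦ ?_⟩
    have : Complex.exp ((-(Real.pi - θ) : ℝ) * Complex.I) = -Complex.exp (θ * Complex.I) := by
      push_cast
      rw [show -((Real.pi : ℂ) - θ) * Complex.I = θ * Complex.I - Real.pi * Complex.I by ring,
        Complex.exp_sub, Complex.exp_pi_mul_I, div_neg, div_one]
    rw [re_inner_exp_smul_left, this, neg_smul, inner_neg_right, Complex.neg_re, neg_eq_zero]

theorem qf_segment {C : H →L[ℂ] H} (hC : IsSelfAdjoint C) (t θ : ℝ) (xm xp : H) :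
    qf C (t • xm + (1 - t) • (Complex.exp (θ * Complex.I) • xp)) =
      t ^ 2 * qf C xm + (1 - t) ^ 2 * qf C xp +
        2 * t * (1 - t) * (⟪Complex.exp (θ * Complex.I) • C xp, xm⟫_ℂ).re := by
  rw [add_comm, qf_add_real_smul hC, qf_unit_smul C (Complex.norm_exp_ofReal_mul_I θ), map_smul]
  ring

/-- The condition that the open segments joining `x₋` to a rotation of `x₊` meet
`Qᵢ ∩ Q_j ∩ Q_k`. -/
def SegmentCondition {m : ℕ} (B : Fin m → (H →L[ℂ] H)) : Prop :=
  ∀ i j k : Fin m, ∀ xm xp : H,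
    qf (B i) xm < 0 → qf (B j) xm = 0 → qf (B k) xm = 0 →
    0 < qf (B i) xp → qf (B j) xp = 0 → qf (B k) xp = 0 →
    ∃ θ : ℝ, θ ∈ Set.Ico 0 Real.pi ∧
      ∃ t : ℝ, t ∈ Set.Ioo (0:ℝ) 1 ∧
        qf (B i) (t • xm + (1 - t) • (Complex.exp (θ * Complex.I) • xp)) = 0 ∧
        qf (B j) (t • xm + (1 - t) • (Complex.exp (θ * Complex.I) • xp)) = 0 ∧
        qf (B k) (t • xm + (1 - t) • (Complex.exp (θ * Complex.I) • xp)) = 0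

theorem angularCondition_iff_segmentCondition {m : ℕ} {B : Fin m → (H →L[ℂ] H)}
    (hB : ∀ i, IsSelfAdjoint (B i)) : AngularCondition B ↔ SegmentCondition B := by
  constructor
  · intro h i j k xm xp hm hmj hmk hp hpj hpk
    obtain ⟨θ, hθ, hj, hk⟩ := h i j k xm xp hm hmj hmk hp hpj hpk
    obtain ⟨η, hη, hiff⟩ := exists_phase_neg (H := H) hθ
    rw [hiff] at hj hk
    obtain ⟨τ, hτ, h0⟩ :=
      exists_pos_root hp hm (⟪Complex.exp (η * Complex.I) • B i xp, xm⟫_ℂ).re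
    have ht : 1 - τ / (1 + τ) = 1 / (1 + τ) := by field_simp; ring
    refine ⟨η, hη, τ / (1 + τ), ⟨by positivity, (div_lt_one (by positivity)).2 (by linarith)⟩,
      ?_, ?_, ?_⟩
    · rw [qf_segment (hB i), ht]
      field_simp
      linear_combination h0
    · rw [qf_segment (hB j), hmj, hpj, hj]; ring
    · rw [qf_segment (hB k), hmk, hpk, hk]; ring
  · intro h i j k xm xp hm hmj hmk hp hpj hpk
    obtain ⟨η, hη, t, ⟨ht0, ht1⟩, -, hj, hk⟩ := h i j k xm xp hm hmj hmk hp hpj hpk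
    obtain ⟨θ, hθ, hiff⟩ := exists_phase_neg (H := H) hη
    have hne : 2 * t * (1 - t) ≠ 0 := by
      have := sub_pos.2 ht1
      positivity
    have cross : ∀ l, qf (B l) xm = 0 → qf (B l) xp = 0 →
        qf (B l) (t • xm + (1 - t) • (Complex.exp (η * Complex.I) • xp)) = 0 →
        (⟪B l xp, Complex.exp (θ * Complex.I) • xm⟫_ℂ).re = 0 := fun l hlm hlp hl ↦ by
      rw [qf_segment (hB l), hlm, hlp, mul_zero, mul_zero, zero_add, zero_add,
        mul_eq_zero_iff_left hne] at hl
      rw [← inner_conj_symm, Complex.conj_re, ← hiff, ← inner_conj_symm, Complex.conj_re]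
      exact hl
    exact ⟨θ, hθ, cross j hmj hpj hj, cross k hmk hpk hk⟩

/-- Characterizations of strong indefiniteness: (i) `{B₁,…,B_m}` is strongly
indefinite; (ii) it is indefinite and the angular condition holds; (iii) for each `i`
there is a common neutral vector outside the kernel of every `∑ μ_j B_j` with
`μ_i ≠ 0`, and the open segment `(x₋, e^{iθ}x₊)` meets `Qᵢ ∩ Q_j ∩ Q_k`. -/
theorem stronglyIndefinite_tfae {m : ℕ} (hm : 2 ≤ m) (B : Fin m → (H →L[ℂ] H))
    (hB : ∀ i, IsSelfAdjoint (B i)) :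
    (StronglyIndefinite B ↔
      (IndefiniteFamily B ∧
        ∀ i j k : Fin m, ∀ xm xp : H,
          qf (B i) xm < 0 → qf (B j) xm = 0 → qf (B k) xm = 0 →
          0 < qf (B i) xp → qf (B j) xp = 0 → qf (B k) xp = 0 →
          ∃ θ : ℝ, θ ∈ Set.Ico 0 Real.pi ∧
            (⟪(B j) xp, Complex.exp (θ * Complex.I) • xm⟫_ℂ).re = 0 ∧
            (⟪(B k) xp, Complex.exp (θ * Complex.I) • xm⟫_ℂ).re = 0)) ∧
    (StronglyIndefinite B ↔
      ((∀ i : Fin m, ∃ x : H, (∀ j, qf (B j) x = 0) ∧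
          ∀ μ : Fin m → ℝ, μ i ≠ 0 → (∑ j, μ j • B j) x ≠ 0) ∧
        ∀ i j k : Fin m, ∀ xm xp : H,
          qf (B i) xm < 0 → qf (B j) xm = 0 → qf (B k) xm = 0 →
          0 < qf (B i) xp → qf (B j) xp = 0 → qf (B k) xp = 0 →
          ∃ θ : ℝ, θ ∈ Set.Ico 0 Real.pi ∧
            ∃ t : ℝ, t ∈ Set.Ioo (0:ℝ) 1 ∧
              qf (B i) (t • xm + (1 - t) • (Complex.exp (θ * Complex.I) • xp)) = 0 ∧
              qf (B j) (t • xm + (1 - t) • (Complex.exp (θ * Complex.I) • xp)) = 0 ∧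
              qf (B k) (t • xm + (1 - t) • (Complex.exp (θ * Complex.I) • xp)) = 0)) := by
  have hangle := angularCondition_iff_segmentCondition hB
  refine ⟨⟨fun h ↦ ⟨h.1.indefiniteFamily hB h.2, h.2⟩, fun h ↦ ⟨h.1.weaklyIndefinite, h.2⟩⟩,
    fun h ↦ ⟨(h.1.indefiniteFamily hB h.2).exists_neutral_notMem_ker hB h.2, hangle.1 h.2⟩,
    fun h ↦ ⟨fun μ hμ ↦ ?_, hangle.2 h.2⟩⟩
  obtain ⟨i, hi⟩ := Function.ne_iff.1 hμ
  obtain ⟨x, hx, hker⟩ := h.1 i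
  exact indefinite_of_neutral_notMem_ker (isSelfAdjoint_sum_real_smul hB μ)
    (by simp [qf_sum_smul, hx]) (hker μ hi)
end
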